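/- Let F be a set of n ≥ 1 firms and W a set of m ≥ 1 workers, where each firm i ∈ F has a monotone, subadditive valuation v_i : 2^W → ℝ≥0 and each worker j ∈ W has a value w_j(i) ≥ 0 for each firm i. Let μ* and μ̄ be many-to-one matchings in which every worker is assigned to exactly one firm and every firm receives a nonempty set of workers. For each firm i, let j*_i ∈ μ*_i maximize v_i({j}) over j ∈ μ*_i, and let j̄_i ∈ μ̄_i be an arbitrary designated worker. If ∏_{i∈F} v_i({j̄_i}) · ∏_{j∈W} w_j(μ̄_j) ≥ ∏_{i∈F} v_i({j*_i}) · ∏_{j∈W} w_j(μ*_j), then 1.33 · NSW(μ̄) ≥ NSW(μ*). -/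

import Mathlib

/-- A subadditive set function is bounded on nonempty sets by the cardinality times a bound on
singletons. -/
theorem le_card_mul_of_subadditive {W : Type*} [DecidableEq W] {f : Finset W → ℝ}
    (hsub : ∀ S T : Finset W, f (S ∪ T) ≤ f S + f T) {c : ℝ} {S : Finset W}
    (hS : S.Nonempty) (hc : ∀ j ∈ S, f {j} ≤ c) : f S ≤ S.card * c := by
  induction hS using Finset.Nonempty.cons_induction with
  | singleton a => simpa using hc a (by simp)
  | cons a s ha hs ih =>
    have h1 := ih fun j hj => hc j (Finset.mem_cons_of_mem hj)
    have h2 := hc a (Finset.mem_cons_self a s)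
    have h3 := hsub {a} s
    rw [← Finset.insert_eq, ← Finset.cons_eq_insert a s ha] at h3
    rw [Finset.card_cons]
    push_cast
    linarith

theorem natCast_le_pow_succ (k : ℕ) : (k : ℝ) ≤ (1.33 : ℝ) ^ (k + 1) := by
  rcases lt_or_ge k 4 with hk | hk
  · interval_cases k <;> norm_num
  · induction k, hk using Nat.le_induction with
    | base => norm_num
    | succ k hk ih =>
      have hk' : (4 : ℝ) ≤ k := by exact_mod_cast hk
      rw [pow_succ]
      push_cast
      linarith


/-- Two-sided model with monotone subadditive firm valuations.  Let `μStar` and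
`μBar` be many-to-one matchings assigning every worker to exactly one firm so
that every firm receives a nonempty set of workers.  For each firm `i`, let
`jStar i` be a worker assigned to `i` under `μStar` maximizing `v i {j}`, and
let `jBar i` be an arbitrary designated worker assigned to `i` under `μBar`.
If `∏ i v i {jBar i} * ∏ j w j (μBar j) ≥ ∏ i v i {jStar i} * ∏ j w j (μStar j)`,
then `1.33 * NSW(μBar) ≥ NSW(μStar)`. -/
theorem nsw_approx_of_prod_ge {F W : Type*} [Fintype F] [Fintype W]
    [DecidableEq F] [DecidableEq W]
    (hF : 1 ≤ Fintype.card F) (hW : 1 ≤ Fintype.card W)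
    (v : F → Finset W → ℝ) (hv0 : ∀ i S, 0 ≤ v i S)
    (hvmono : ∀ i (S T : Finset W), S ⊆ T → v i S ≤ v i T)
    (hvsub : ∀ i (S T : Finset W), v i (S ∪ T) ≤ v i S + v i T)
    (w : W → F → ℝ) (hw0 : ∀ j i, 0 ≤ w j i)
    (μStar μBar : W → F)
    (hneStar : ∀ i : F, (Finset.univ.filter fun j => μStar j = i).Nonempty)
    (hneBar : ∀ i : F, (Finset.univ.filter fun j => μBar j = i).Nonempty)
    (jStar : F → W) (hjStar : ∀ i, μStar (jStar i) = i)
    (hjStarMax : ∀ i j, μStar j = i → v i {j} ≤ v i {jStar i})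
    (jBar : F → W) (hjBar : ∀ i, μBar (jBar i) = i)
    (hprod : (∏ i, v i {jStar i}) * ∏ j, w j (μStar j) ≤
      (∏ i, v i {jBar i}) * ∏ j, w j (μBar j)) :
    ((∏ i, v i (Finset.univ.filter fun j => μStar j = i)) * ∏ j, w j (μStar j)) ^
        ((1 : ℝ) / (Fintype.card W + Fintype.card F)) ≤
      1.33 * ((∏ i, v i (Finset.univ.filter fun j => μBar j = i)) * ∏ j, w j (μBar j)) ^
        ((1 : ℝ) / (Fintype.card W + Fintype.card F)) := by
  set P : ℝ := ∏ j, w j (μStar j)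
  set Q : ℝ := ∏ j, w j (μBar j)
  have hP : 0 ≤ P := Finset.prod_nonneg fun j _ => hw0 _ _
  have hQ : 0 ≤ Q := Finset.prod_nonneg fun j _ => hw0 _ _
  have hcard : ∑ i, ((Finset.univ.filter fun j => μStar j = i).card + 1) =
      Fintype.card W + Fintype.card F := by
    rw [Finset.sum_add_distrib, ← Finset.card_eq_sum_card_fiberwise (by simp)]
    simp
  have hstar : ∏ i, v i (Finset.univ.filter fun j => μStar j = i) ≤
      (1.33 : ℝ) ^ (Fintype.card W + Fintype.card F) * ∏ i, v i {jStar i} := by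
    rw [← hcard, ← Finset.prod_pow_eq_pow_sum, ← Finset.prod_mul_distrib]
    refine Finset.prod_le_prod (fun i _ => hv0 _ _) fun i _ => ?_
    refine (le_card_mul_of_subadditive (hvsub i) (hneStar i) (c := v i {jStar i}) ?_).trans
      (mul_le_mul_of_nonneg_right (natCast_le_pow_succ _) (hv0 _ _))
    intro j hj
    exact hjStarMax i j (by simpa using hj)
  have hbar : ∏ i, v i {jBar i} ≤ ∏ i, v i (Finset.univ.filter fun j => μBar j = i) :=
    Finset.prod_le_prod (fun i _ => hv0 _ _) fun i _ => hvmono i _ _ (by simp [hjBar])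
  have hle : (∏ i, v i (Finset.univ.filter fun j => μStar j = i)) * P ≤
      (1.33 : ℝ) ^ (Fintype.card W + Fintype.card F) *
        ((∏ i, v i (Finset.univ.filter fun j => μBar j = i)) * Q) :=
    calc _ ≤ (1.33 : ℝ) ^ (Fintype.card W + Fintype.card F) * (∏ i, v i {jStar i}) * P :=
          mul_le_mul_of_nonneg_right hstar hP
      _ = (1.33 : ℝ) ^ (Fintype.card W + Fintype.card F) * ((∏ i, v i {jStar i}) * P) := by ring
      _ ≤ _ := mul_le_mul_of_nonneg_left
          (hprod.trans (mul_le_mul_of_nonneg_right hbar hQ)) (by positivity)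
  have hroot : ((1.33 : ℝ) ^ (Fintype.card W + Fintype.card F)) ^
      ((1 : ℝ) / (Fintype.card W + Fintype.card F)) = 1.33 := by
    have h := Real.pow_rpow_inv_natCast (x := 1.33) (n := Fintype.card W + Fintype.card F)
      (by norm_num) (by omega)
    rwa [Nat.cast_add, ← one_div] at h
  refine (Real.rpow_le_rpow (mul_nonneg (Finset.prod_nonneg fun i _ => hv0 _ _) hP) hle
    (by positivity)).trans_eq ?_
  rw [Real.mul_rpow (by positivity)
    (mul_nonneg (Finset.prod_nonneg fun i _ => hv0 _ _) hQ), hroot]
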